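/- Let C be the projective variety in \u2119\u00b3 cut out by the two homogeneous polynomials XY + ZT and T\u00b2X + TX\u00b2 + Y\u00b3 + X\u00b2Z + XZ\u00b2 (with coefficients 0,1). Then: for every finite field K with |K| = 2, C has exactly 5 K-points; for every finite field K with |K| = 4, C has exactly 9 K-points; for every finite field K with |K| = 8, C has exactly 11 K-points; and for every finite field K with |K| = 16, C has exactly 17 K-points. -/

import Mathlib

open MvPolynomial

/-- The quadric `XY + ZT` in `ℙ³`. -/
noncomputable def quadF (K : Type) [Field K] : MvPolynomial (Fin 4) K :=
  X 0 * X 1 + X 2 * X 3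

/-- The cubic `T²X + TX² + Y³ + X²Z + XZ²`. -/
noncomputable def cubicG (K : Type) [Field K] : MvPolynomial (Fin 4) K :=
  X 3 ^ 2 * X 0 + X 3 * X 0 ^ 2 + X 1 ^ 3 + X 0 ^ 2 * X 2 + X 0 * X 2 ^ 2

/-- The set of `K`-points of the projective variety `V(f, g) ⊆ ℙ³`. -/
def projPoints (K : Type) [Field K] (f g : MvPolynomial (Fin 4) K) : Type :=
  {p : Projectivization K (Fin 4 → K) //
    MvPolynomial.eval p.rep f = 0 ∧ MvPolynomial.eval p.rep g = 0}

/-- Affine solutions of the dehomogenised equation (chart `X = 1`, `Y = -ZT`). -/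
abbrev AffSol (K : Type) [Field K] : Type :=
  {p : K × K // p.2 ^ 2 + p.2 + (-(p.1 * p.2)) ^ 3 + p.1 + p.1 ^ 2 = 0}

/-- The two equations, on vectors. -/
def OnC {K : Type} [Field K] (v : Fin 4 → K) : Prop :=
  v 0 * v 1 + v 2 * v 3 = 0 ∧
  v 3 ^ 2 * v 0 + v 3 * v 0 ^ 2 + v 1 ^ 3 + v 0 ^ 2 * v 2 + v 0 * v 2 ^ 2 = 0

theorem onC_smul {K : Type} [Field K] (a : K) {v : Fin 4 → K} (h : OnC v) : OnC (a • v) := by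
  obtain ⟨h1, h2⟩ := h
  constructor
  · simp only [Pi.smul_apply, smul_eq_mul]
    linear_combination a ^ 2 * h1
  · simp only [Pi.smul_apply, smul_eq_mul]
    linear_combination a ^ 3 * h2

theorem eval_iff {K : Type} [Field K] (v : Fin 4 → K) :
    (MvPolynomial.eval v (quadF K) = 0 ∧ MvPolynomial.eval v (cubicG K) = 0) ↔ OnC v := by
  simp [quadF, cubicG, OnC]

theorem onC_rep_mk {K : Type} [Field K] (v : Fin 4 → K) (hv : v ≠ 0) (h : OnC v) :
    OnC (Projectivization.mk K v hv).rep := by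
  obtain ⟨a, ha⟩ := Projectivization.exists_smul_eq_mk_rep K v hv
  rw [← ha]
  exact onC_smul (a : K) h

/-- Representatives of the points. -/
def vec {K : Type} [Field K] : Option (Option (AffSol K)) → Fin 4 → K
  | none => ![0, 0, 1, 0]
  | some none => ![0, 0, 0, 1]
  | some (some p) => ![1, -(p.1.1 * p.1.2), p.1.1, p.1.2]

theorem vec_ne {K : Type} [Field K] (s : Option (Option (AffSol K))) : vec s ≠ 0 := by
  intro h
  rcases s with _ | _ | p
  · simpa [vec] using congrFun h 2
  · simpa [vec] using congrFun h 3
  · simpa [vec] using congrFun h 0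

theorem vec_onC {K : Type} [Field K] (s : Option (Option (AffSol K))) : OnC (vec s) := by
  rcases s with _ | _ | ⟨p, hp⟩
  · simp [vec, OnC]
  · simp [vec, OnC]
  · constructor
    · simp [vec]
    · simp [vec]
      linear_combination hp

/-- Parametrisation of the points. -/
def toPt {K : Type} [Field K] (s : Option (Option (AffSol K))) :
    projPoints K (quadF K) (cubicG K) :=
  ⟨Projectivization.mk K (vec s) (vec_ne s), (eval_iff _).2 (onC_rep_mk _ _ (vec_onC s))⟩

theorem toPt_bij {K : Type} [Field K] : Function.Bijective (toPt (K := K)) := by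
  constructor
  · intro s t h
    have h' := congrArg Subtype.val h
    simp only [toPt] at h'
    rw [Projectivization.mk_eq_mk_iff'] at h'
    obtain ⟨a, ha⟩ := h'
    have e0 := congrFun ha 0
    have e2 := congrFun ha 2
    have e3 := congrFun ha 3
    rcases s with _ | _ | ⟨⟨z, w⟩, hp⟩ <;> rcases t with _ | _ | ⟨⟨z', w'⟩, hp'⟩ <;>
      simp [vec] at e0 e2 e3 ⊢ <;> simp_all
  · rintro ⟨p, hp⟩
    have hC := (eval_iff _).1 hp
    have key : ∀ s : Option (Option (AffSol K)), (∃ a : K, a • vec s = p.rep) →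
        ∃ s, toPt s = ⟨p, hp⟩ := by
      rintro s ⟨a, ha⟩
      refine ⟨s, Subtype.ext ?_⟩
      simp only [toPt]
      rw [← p.mk_rep, Eq.comm, Projectivization.mk_eq_mk_iff']
      exact ⟨a, ha⟩
    have hne := p.rep_nonzero
    generalize p.rep = v at hC key hne
    obtain ⟨h1, h2⟩ := hC
    by_cases h0 : v 0 = 0
    · have hy : v 1 = 0 := by
        rw [h0] at h2
        simpa using h2
      have hzt : v 2 = 0 ∨ v 3 = 0 := by
        rw [h0] at h1
        simpa using h1
      rcases hzt with hz | ht
      · refine key (some none) ⟨v 3, ?_⟩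
        ext i
        fin_cases i <;> simp [vec, h0, hy, hz]
      · refine key none ⟨v 2, ?_⟩
        ext i
        fin_cases i <;> simp [vec, h0, hy, ht]
    · have hy : v 1 = -(v 2 * v 3) / v 0 := by
        field_simp
        linear_combination h1
      refine key (some (some ⟨(v 2 / v 0, v 3 / v 0), ?_⟩)) ⟨v 0, ?_⟩
      · rw [hy] at h2
        simp only
        field_simp at h2 ⊢
        linear_combination h2
      · ext i
        fin_cases i <;> simp [vec, hy] <;> field_simp

theorem card_eq {K : Type} [Field K] [Finite K] :
    Nat.card (projPoints K (quadF K) (cubicG K)) = Nat.card (AffSol K) + 2 := by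
  rw [← Nat.card_congr (Equiv.ofBijective _ (toPt_bij (K := K))), Finite.card_option,
    Finite.card_option]

theorem affSol_congr {K L : Type} [Field K] [Field L] (e : K ≃+* L) :
    Nat.card (AffSol K) = Nat.card (AffSol L) := by
  refine Nat.card_congr ((Equiv.prodCongr e.toEquiv e.toEquiv).subtypeEquiv ?_)
  rintro ⟨z, t⟩
  rw [← e.map_eq_zero_iff]
  simp

theorem transfer (L : Type) [Field L] [Fintype L] [DecidableEq L] (q n : ℕ)
    (hL : Fintype.card L = q)
    (hn : Fintype.card (AffSol L) = n)
    (K : Type) [Field K] [Fintype K] (hK : Fintype.card K = q) :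
    Nat.card (projPoints K (quadF K) (cubicG K)) = n + 2 := by
  rw [card_eq, affSol_congr (FiniteField.ringEquivOfCardEq (K := K) (K' := L) (hK.trans hL.symm)),
    Nat.card_eq_fintype_card, hn]

/-- Product of binary polynomials modulo the polynomial `m`, whose top bit is `q`. -/
def gmul (q m a b : ℕ) : ℕ :=
  let s (x : ℕ) : ℕ := if 2 * x < q then 2 * x else Nat.xor (2 * x) m
  let c (i x : ℕ) : ℕ := if b.testBit i then x else 0
  Nat.xor (Nat.xor (c 0 a) (c 1 (s a))) (Nat.xor (c 2 (s (s a))) (c 3 (s (s (s a)))))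

/-- A copy of `Fin q` carrying the binary field arithmetic. -/
structure GF (q m : ℕ) where
  /-- the bit pattern -/
  val : Fin q

namespace GF
variable {q m : ℕ}

/-- The obvious bijection. -/
def equivFin : GF q m ≃ Fin q := ⟨val, mk, fun _ => rfl, fun _ => rfl⟩

instance : DecidableEq (GF q m) := fun a b =>
  decidable_of_iff (a.val = b.val) ⟨fun h => by cases a; cases b; cases h; rfl, fun h => h ▸ rfl⟩
instance : Fintype (GF q m) := Fintype.ofEquiv _ equivFin.symm

theorem card : Fintype.card (GF q m) = q := by
  rw [Fintype.card_congr equivFin, Fintype.card_fin]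

variable [NeZero q]
instance : Add (GF q m) := ⟨fun a b => ⟨Fin.ofNat q (Nat.xor a.val.val b.val.val)⟩⟩
instance : Mul (GF q m) := ⟨fun a b => ⟨Fin.ofNat q (gmul q m a.val.val b.val.val)⟩⟩
instance : Zero (GF q m) := ⟨⟨Fin.ofNat q 0⟩⟩
instance : One (GF q m) := ⟨⟨Fin.ofNat q 1⟩⟩
instance : Neg (GF q m) := ⟨fun a => a⟩
/-- The inverse `a ^ (q - 2)`. -/
instance : Inv (GF q m) := ⟨fun a => Nat.rec 1 (fun _ r => r * a) (q - 2)⟩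

/-- A field from the checked axioms. -/
@[reducible] def mkField (q m : ℕ) [NeZero q]
    (h1 : ∀ a b c : GF q m, a + b + c = a + (b + c) ∧ a * b * c = a * (b * c) ∧
      a * (b + c) = a * b + a * c)
    (h2 : ∀ a b : GF q m, a + b = b + a ∧ a * b = b * a)
    (h3 : ∀ a : GF q m, 0 + a = a ∧ 1 * a = a ∧ -a + a = 0 ∧ 0 * a = 0 ∧ (a ≠ 0 → a * a⁻¹ = 1))
    (h4 : (0 : GF q m)⁻¹ = 0 ∧ (0 : GF q m) ≠ 1) : Field (GF q m) where
  add_assoc a b c := (h1 a b c).1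
  zero_add a := (h3 a).1
  add_zero a := by rw [(h2 a 0).1]; exact (h3 a).1
  add_comm a b := (h2 a b).1
  mul_assoc a b c := (h1 a b c).2.1
  one_mul a := (h3 a).2.1
  mul_one a := by rw [(h2 a 1).2]; exact (h3 a).2.1
  mul_comm a b := (h2 a b).2
  left_distrib a b c := (h1 a b c).2.2
  right_distrib a b c := by
    rw [(h2 (a + b) c).2, (h2 a c).2, (h2 b c).2]; exact (h1 c a b).2.2
  zero_mul a := (h3 a).2.2.2.1
  mul_zero a := by rw [(h2 a 0).2]; exact (h3 a).2.2.2.1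
  neg_add_cancel a := (h3 a).2.2.1
  nsmul := nsmulRec
  zsmul := zsmulRec
  exists_pair_ne := ⟨0, 1, h4.2⟩
  mul_inv_cancel a := (h3 a).2.2.2.2
  inv_zero := h4.1
  nnqsmul := _
  qsmul := _

end GF

instance fieldFour : Field (GF 4 7) := GF.mkField 4 7 (by decide +kernel) (by decide +kernel)
  (by decide +kernel) (by decide +kernel)
instance fieldEight : Field (GF 8 11) := GF.mkField 8 11 (by decide +kernel) (by decide +kernel)
  (by decide +kernel) (by decide +kernel)
instance fieldSixteen : Field (GF 16 19) := GF.mkField 16 19 (by decide +kernel)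
  (by decide +kernel) (by decide +kernel) (by decide +kernel)

theorem stmt1 :
    (∀ (K : Type) [Field K] [Fintype K], Fintype.card K = 2 →
      Nat.card (projPoints K (quadF K) (cubicG K)) = 5) ∧
    (∀ (K : Type) [Field K] [Fintype K], Fintype.card K = 4 →
      Nat.card (projPoints K (quadF K) (cubicG K)) = 9) ∧
    (∀ (K : Type) [Field K] [Fintype K], Fintype.card K = 8 →
      Nat.card (projPoints K (quadF K) (cubicG K)) = 11) ∧
    (∀ (K : Type) [Field K] [Fintype K], Fintype.card K = 16 →
      Nat.card (projPoints K (quadF K) (cubicG K)) = 17) := by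
  refine ⟨?_, ?_, ?_, ?_⟩
  · intro K _ _ h
    exact transfer (ZMod 2) 2 3 (ZMod.card 2) (by decide +kernel) K h
  · intro K _ _ h
    exact transfer (GF 4 7) 4 7 GF.card (by decide +kernel) K h
  · intro K _ _ h
    exact transfer (GF 8 11) 8 9 GF.card (by decide +kernel) K h
  · intro K _ _ h
    exact transfer (GF 16 19) 16 15 GF.card (by decide +kernel) K h
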